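/- arXiv:2004.04553 — 3 statements merged into one kernel-verified Lean document; each statement's English description precedes it below -/
import Mathlib

section
/- For c > 0, define P(c) = 2c²(θ₃(c)·θ₃''(c) − θ₃'(c)²) + 2c·θ₃(c)·θ₃'(c) and Q(c) = 2c²(θ₄(c)·θ₄''(c) − θ₄'(c)²) + 2c·θ₄(c)·θ₄'(c). Then for all β > α > 0, one has −Q(αV) > 0 for all V > 0, and lim_{V→∞} e^{πV(β−α)} · P(βV)/(−Q(αV)) = β²/α². -/
open Filter

noncomputable section

/-- Jacobi theta function `θ₃(x) = Σ_{k∈ℤ} e^{-πxk²}`. -/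
def theta3 (x : ℝ) : ℝ := ∑' k : ℤ, Real.exp (-Real.pi * x * (k : ℝ) ^ 2)

/-- Jacobi theta function `θ₄(x) = Σ_{k∈ℤ} (-1)^k e^{-πxk²}`. -/
def theta4 (x : ℝ) : ℝ := ∑' k : ℤ, (-1 : ℝ) ^ k * Real.exp (-Real.pi * x * (k : ℝ) ^ 2)

/-- `P(c) = 2c²(θ₃(c)θ₃''(c) - θ₃'(c)²) + 2cθ₃(c)θ₃'(c)`, the second derivative
at `y = 1` of `y ↦ θ₃(cy)θ₃(c/y)`. -/
def Pfun (c : ℝ) : ℝ :=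
  2 * c ^ 2 * (theta3 c * deriv (deriv theta3) c - (deriv theta3 c) ^ 2)
    + 2 * c * theta3 c * deriv theta3 c

/-- `Q(c) = 2c²(θ₄(c)θ₄''(c) - θ₄'(c)²) + 2cθ₄(c)θ₄'(c)`, the second derivative
at `y = 1` of `y ↦ θ₄(cy)θ₄(c/y)`. -/
def Qfun (c : ℝ) : ℝ :=
  2 * c ^ 2 * (theta4 c * deriv (deriv theta4) c - (deriv theta4 c) ^ 2)
    + 2 * c * theta4 c * deriv theta4 c

/-- The series `Σ_{k∈ℤ} a_k (-πk²)ⁿ e^{-πxk²}`, which for bounded `a` is the `n`-th derivative of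
`Σ_{k∈ℤ} a_k e^{-πxk²}`. -/
def thetaSeries (a : ℤ → ℝ) (n : ℕ) (x : ℝ) : ℝ :=
  ∑' k : ℤ, a k * (-Real.pi * (k : ℝ) ^ 2) ^ n * Real.exp (-Real.pi * x * (k : ℝ) ^ 2)

lemma summable_sq_pow_mul_exp (n : ℕ) {x : ℝ} (hx : 0 < x) :
    Summable fun k : ℤ => (Real.pi * (k : ℝ) ^ 2) ^ n * Real.exp (-Real.pi * x * (k : ℝ) ^ 2) := by
  refine ((summable_pow_mul_jacobiTheta₂_term_bound 0 hx (2 * n)).mul_left (Real.pi ^ n)).congr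
    fun k => ?_
  rw [Int.cast_abs, pow_mul, sq_abs, mul_pow]
  ring_nf

lemma norm_thetaSeries_term_le {a : ℤ → ℝ} (ha : ∀ k, |a k| ≤ 1) (n : ℕ) {x y : ℝ} (hxy : x ≤ y)
    (k : ℤ) :
    ‖a k * (-Real.pi * (k : ℝ) ^ 2) ^ n * Real.exp (-Real.pi * y * (k : ℝ) ^ 2)‖ ≤
      (Real.pi * (k : ℝ) ^ 2) ^ n * Real.exp (-Real.pi * x * (k : ℝ) ^ 2) := by
  have hpi := Real.pi_pos
  have habs : |-Real.pi * (k : ℝ) ^ 2| = Real.pi * (k : ℝ) ^ 2 := by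
    rw [neg_mul, abs_neg, abs_of_nonneg (by positivity)]
  rw [Real.norm_eq_abs, abs_mul, abs_mul, abs_pow, habs, Real.abs_exp]
  refine mul_le_mul (mul_le_of_le_one_left (by positivity) (ha k)) ?_ (by positivity)
    (by positivity)
  refine Real.exp_le_exp.mpr ?_
  have : 0 ≤ Real.pi * (k : ℝ) ^ 2 * (y - x) :=
    mul_nonneg (by positivity) (sub_nonneg.mpr hxy)
  linarith

lemma hasDerivAt_thetaSeries {a : ℤ → ℝ} (ha : ∀ k, |a k| ≤ 1) (n : ℕ) {x : ℝ} (hx : 0 < x) :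
    HasDerivAt (thetaSeries a n) (thetaSeries a (n + 1) x) x := by
  have hx2 : x / 2 < x := by linarith
  refine hasDerivAt_tsum_of_isPreconnected (t := Set.Ioi (x / 2))
    (summable_sq_pow_mul_exp (n + 1) (half_pos hx)) isOpen_Ioi isPreconnected_Ioi
    (fun k y _ => ?_) (fun k y hy => norm_thetaSeries_term_le ha (n + 1) (le_of_lt hy) k) hx2
    ((summable_sq_pow_mul_exp n hx).of_norm_bounded
      fun k => norm_thetaSeries_term_le ha n le_rfl k) hx2
  have h : HasDerivAt (fun y : ℝ => -Real.pi * y * (k : ℝ) ^ 2) (-Real.pi * (k : ℝ) ^ 2) y := by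
    simpa using ((hasDerivAt_id y).const_mul (-Real.pi)).mul_const ((k : ℝ) ^ 2)
  exact (h.exp.const_mul (a k * (-Real.pi * (k : ℝ) ^ 2) ^ n)).congr_deriv (by ring)

lemma deriv_thetaSeries {a : ℤ → ℝ} (ha : ∀ k, |a k| ≤ 1) {x : ℝ} (hx : 0 < x) :
    deriv (thetaSeries a 0) x = thetaSeries a 1 x :=
  (hasDerivAt_thetaSeries ha 0 hx).deriv

lemma deriv_deriv_thetaSeries {a : ℤ → ℝ} (ha : ∀ k, |a k| ≤ 1) {x : ℝ} (hx : 0 < x) :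
    deriv (deriv (thetaSeries a 0)) x = thetaSeries a 2 x := by
  have h : deriv (thetaSeries a 0) =ᶠ[nhds x] thetaSeries a 1 := by
    filter_upwards [lt_mem_nhds hx] with y hy using deriv_thetaSeries ha hy
  exact h.deriv_eq.trans (hasDerivAt_thetaSeries ha 1 hx).deriv

lemma theta3_eq_thetaSeries : theta3 = thetaSeries (fun _ => 1) 0 := by
  ext x
  simp [theta3, thetaSeries]

lemma theta4_eq_thetaSeries : theta4 = thetaSeries (fun k => (-1) ^ k) 0 := by
  ext x
  simp [theta4, thetaSeries]

lemma abs_neg_one_zpow_le (k : ℤ) : |(-1 : ℝ) ^ k| ≤ 1 := by simp [abs_zpow]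

lemma tendsto_exp_neg_mul_atTop {b : ℝ} (hb : 0 < b) :
    Tendsto (fun x : ℝ => Real.exp (-(b * x))) atTop (nhds 0) :=
  Real.tendsto_exp_neg_atTop_nhds_zero.comp (tendsto_id.const_mul_atTop hb)

lemma tendsto_thetaSeries_zero {a : ℤ → ℝ} (ha : ∀ k, |a k| ≤ 1) :
    Tendsto (thetaSeries a 0) atTop (nhds (a 0)) := by
  have hsum : ∑' k : ℤ, (if k = 0 then a 0 else 0) = a 0 := by simp
  rw [← hsum]
  refine tendsto_tsum_of_dominated_convergence (summable_sq_pow_mul_exp 0 one_pos) (fun k => ?_)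
    ((eventually_ge_atTop 1).mono fun x hx k => norm_thetaSeries_term_le ha 0 hx k)
  split_ifs with hk
  · simp [hk]
  · have hk' : 0 < Real.pi * (k : ℝ) ^ 2 := by positivity
    convert (tendsto_exp_neg_mul_atTop hk').const_mul (a k) using 2 with x
    · rw [pow_zero, mul_one]; ring_nf
    · simp

lemma tendsto_exp_mul_thetaSeries_succ {a : ℤ → ℝ} (ha : ∀ k, |a k| ≤ 1) (n : ℕ) :
    Tendsto (fun x => Real.exp (Real.pi * x) * thetaSeries a (n + 1) x) atTop
      (nhds ((-Real.pi) ^ (n + 1) * (a 1 + a (-1)))) := by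
  have hsum : ∑' k : ℤ, (if k ∈ ({1, -1} : Finset ℤ) then (-Real.pi) ^ (n + 1) * a k else 0) =
      (-Real.pi) ^ (n + 1) * (a 1 + a (-1)) := by
    rw [tsum_eq_sum (s := {1, -1}) (fun k hk => if_neg hk), Finset.sum_pair (by norm_num)]
    simp [mul_add]
  rw [← hsum]
  simp_rw [thetaSeries, ← tsum_mul_left]
  refine tendsto_tsum_of_dominated_convergence
    ((summable_sq_pow_mul_exp (n + 1) one_pos).mul_left (Real.exp Real.pi)) (fun k => ?_)
    ((eventually_ge_atTop 1).mono fun x hx k => ?_)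
  · have hterm : ∀ x : ℝ, Real.exp (Real.pi * x) *
        (a k * (-Real.pi * (k : ℝ) ^ 2) ^ (n + 1) * Real.exp (-Real.pi * x * (k : ℝ) ^ 2)) =
        a k * (-Real.pi * (k : ℝ) ^ 2) ^ (n + 1) *
          Real.exp (-(Real.pi * ((k : ℝ) ^ 2 - 1) * x)) := fun x => by
      rw [mul_left_comm, ← Real.exp_add]
      ring_nf
    simp_rw [hterm]
    split_ifs with hk
    · have hk2 : (k : ℝ) ^ 2 = 1 := by
        rcases Finset.mem_insert.mp hk with rfl | hk
        · simp
        · simp [Finset.mem_singleton.mp hk]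
      simp [hk2, mul_comm]
    · rcases eq_or_ne k 0 with rfl | hk0
      · simp
      · have hk2 : (1 : ℝ) < (k : ℝ) ^ 2 := by
          have h1 : 1 < |k| := by
            simp only [Finset.mem_insert, Finset.mem_singleton] at hk
            rcases abs_cases k with h | h <;> omega
          have h2 : (1 : ℝ) < |(k : ℝ)| := by exact_mod_cast h1
          rw [← sq_abs]
          nlinarith
        simpa only [mul_zero] using (tendsto_exp_neg_mul_atTop
          (mul_pos Real.pi_pos (sub_pos.mpr hk2))).const_mul
            (a k * (-Real.pi * (k : ℝ) ^ 2) ^ (n + 1))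
  · rcases eq_or_ne k 0 with rfl | hk0
    · simp
    have hk2 : (1 : ℝ) ≤ (k : ℝ) ^ 2 := by
      have h1 : (1 : ℝ) ≤ |(k : ℝ)| := by exact_mod_cast Int.one_le_abs hk0
      rw [← sq_abs]
      nlinarith
    have hbound := norm_thetaSeries_term_le ha (n + 1) (le_refl (0 : ℝ)) k
    rw [mul_zero, zero_mul, Real.exp_zero, mul_one, mul_one] at hbound
    rw [mul_left_comm, norm_mul, mul_left_comm]
    refine mul_le_mul hbound ?_ (norm_nonneg _) (by positivity)
    rw [← Real.exp_add, ← Real.exp_add, Real.norm_eq_abs, Real.abs_exp]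
    refine Real.exp_le_exp.mpr ?_
    have : 0 ≤ Real.pi * (((k : ℝ) ^ 2 - 1) * (x - 1)) :=
      mul_nonneg Real.pi_pos.le (mul_nonneg (by linarith) (by linarith))
    nlinarith

/-- `2c²(θθ'' - θ'²) + 2cθθ'` for `θ = Σ_{k∈ℤ} a_k e^{-πxk²}`. -/
def thetaCurvature (a : ℤ → ℝ) (c : ℝ) : ℝ :=
  2 * c ^ 2 * (thetaSeries a 0 c * thetaSeries a 2 c - (thetaSeries a 1 c) ^ 2)
    + 2 * c * thetaSeries a 0 c * thetaSeries a 1 c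

lemma Pfun_eq_thetaCurvature {c : ℝ} (hc : 0 < c) : Pfun c = thetaCurvature (fun _ => 1) c := by
  have ha : ∀ k : ℤ, |(fun _ => (1 : ℝ)) k| ≤ 1 := by simp
  rw [Pfun, theta3_eq_thetaSeries, deriv_thetaSeries ha hc, deriv_deriv_thetaSeries ha hc,
    thetaCurvature]

lemma Qfun_eq_thetaCurvature {c : ℝ} (hc : 0 < c) :
    Qfun c = thetaCurvature (fun k => (-1) ^ k) c := by
  rw [Qfun, theta4_eq_thetaSeries, deriv_thetaSeries abs_neg_one_zpow_le hc,
    deriv_deriv_thetaSeries abs_neg_one_zpow_le hc, thetaCurvature]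

lemma tendsto_thetaCurvature {a : ℤ → ℝ} (ha : ∀ k, |a k| ≤ 1) :
    Tendsto (fun c => Real.exp (Real.pi * c) / c ^ 2 * thetaCurvature a c) atTop
      (nhds (2 * Real.pi ^ 2 * a 0 * (a 1 + a (-1)))) := by
  have h0 := tendsto_thetaSeries_zero ha
  have h1 := tendsto_exp_mul_thetaSeries_succ ha 0
  have h2 := tendsto_exp_mul_thetaSeries_succ ha 1
  have hE := tendsto_exp_neg_mul_atTop Real.pi_pos
  have hlim := (((h0.mul h2).sub (hE.mul (h1.pow 2))).const_mul 2).add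
    ((tendsto_inv_atTop_zero.mul (h0.mul h1)).const_mul 2)
  have hval : 2 * (a 0 * ((-Real.pi) ^ (1 + 1) * (a 1 + a (-1))) -
      0 * ((-Real.pi) ^ (0 + 1) * (a 1 + a (-1))) ^ 2) +
      2 * (0 * (a 0 * ((-Real.pi) ^ (0 + 1) * (a 1 + a (-1))))) =
      2 * Real.pi ^ 2 * a 0 * (a 1 + a (-1)) := by ring
  rw [hval] at hlim
  refine hlim.congr' ((eventually_gt_atTop 0).mono fun c hc => ?_)
  simp only [thetaCurvature, Real.exp_neg]
  have := Real.exp_ne_zero (Real.pi * c)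
  field_simp

lemma tendsto_ratio {α β : ℝ} (hα : 0 < α) (hβ : 0 < β) :
    Tendsto (fun V : ℝ =>
        Real.exp (Real.pi * V * (β - α)) * Pfun (β * V) / (-Qfun (α * V)))
      atTop (nhds (β ^ 2 / α ^ 2)) := by
  have hpi := Real.pi_ne_zero
  have hP := (tendsto_thetaCurvature (a := fun _ => 1) (by simp)).comp
    (tendsto_id.const_mul_atTop hβ)
  have hQ := (tendsto_thetaCurvature abs_neg_one_zpow_le).comp (tendsto_id.const_mul_atTop hα)
  have hlim := (hP.div hQ.neg (by simp)).const_mul (β ^ 2 / α ^ 2)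
  convert hlim.congr' ((eventually_gt_atTop 0).mono fun V hV => ?_) using 2
  · simp; field_simp; norm_num
  · have hαV := mul_pos hα hV
    have hβV := mul_pos hβ hV
    simp only [Function.comp_apply, id_eq, Pi.div_apply, Pfun_eq_thetaCurvature hβV,
      Qfun_eq_thetaCurvature hαV]
    have hexp : Real.exp (Real.pi * V * (β - α)) =
        Real.exp (Real.pi * (β * V)) / Real.exp (Real.pi * (α * V)) := by
      rw [← Real.exp_sub]
      ring_nf
    have := Real.exp_ne_zero (Real.pi * (α * V))
    rw [hexp]
    field_simp

lemma one_sub_pow_pos {q : ℝ} (h0 : 0 < q) (h1 : q < 1) {m : ℕ} (hm : m ≠ 0) : 0 < 1 - q ^ m :=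
  sub_pos.mpr (pow_lt_one₀ h0.le h1 hm)

/-- The ratio `[2N choose N+k] / [2N choose N]` of Gaussian binomial coefficients in base `q²`. -/
def centralRatio (q : ℝ) (N k : ℕ) : ℝ :=
  ∏ j ∈ Finset.range k, (1 - q ^ (2 * (N - j))) / (1 - q ^ (2 * (N + j + 1)))

lemma centralRatio_zero (q : ℝ) (N : ℕ) : centralRatio q N 0 = 1 := rfl

lemma centralRatio_succ (q : ℝ) (N k : ℕ) :
    centralRatio q N (k + 1) =
      centralRatio q N k * ((1 - q ^ (2 * (N - k))) / (1 - q ^ (2 * (N + k + 1)))) :=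
  Finset.prod_range_succ _ _

lemma centralRatio_eq_zero (q : ℝ) {N k : ℕ} (h : N < k) : centralRatio q N k = 0 :=
  Finset.prod_eq_zero (Finset.mem_range.mpr h) (by simp)

lemma abs_centralRatio_le {q : ℝ} (h0 : 0 < q) (h1 : q < 1) (N k : ℕ) :
    |centralRatio q N k| ≤ 1 := by
  rw [centralRatio, Finset.abs_prod]
  refine Finset.prod_le_one (fun _ _ => abs_nonneg _) fun j _ => ?_
  have hd := one_sub_pow_pos h0 h1 (m := 2 * (N + j + 1)) (by omega)
  have hn : 0 ≤ 1 - q ^ (2 * (N - j)) := sub_nonneg.mpr (pow_le_one₀ h0.le h1.le)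
  rw [abs_of_nonneg (div_nonneg hn hd.le), div_le_one hd]
  exact sub_le_sub_left (pow_le_pow_of_le_one h0.le h1.le (by omega)) 1

lemma tendsto_centralRatio {q : ℝ} (h0 : 0 < q) (h1 : q < 1) (k : ℕ) :
    Tendsto (fun N => centralRatio q N k) atTop (nhds 1) := by
  have hpow : ∀ m : ℕ → ℕ, Tendsto m atTop atTop →
      Tendsto (fun N => 1 - q ^ m N) atTop (nhds 1) := fun m hm => by
    simpa using ((tendsto_pow_atTop_nhds_zero_of_lt_one h0.le h1).comp hm).const_sub 1
  have hfac : ∀ j : ℕ, Tendsto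
      (fun N => (1 - q ^ (2 * (N - j))) / (1 - q ^ (2 * (N + j + 1)))) atTop (nhds 1) := fun j => by
    have hn := hpow (fun N => 2 * (N - j))
      (tendsto_atTop_mono (fun N => by omega) (tendsto_sub_atTop_nat j))
    have hd := hpow (fun N => 2 * (N + j + 1))
      (tendsto_atTop_mono (fun N => by rw [id]; omega) tendsto_id)
    simpa only [Pi.div_def, div_one] using hn.div hd one_ne_zero
  simpa only [Finset.prod_const_one, centralRatio] using tendsto_finsetProd (Finset.range k) fun j _ => hfac j

lemma centralRatio_mul_sq {q : ℝ} (h0 : 0 < q) (h1 : q < 1) (N k : ℕ) :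
    centralRatio q N k * (1 - q ^ (2 * (N + 1))) ^ 2 =
      centralRatio q (N + 1) k *
        ((1 - q ^ (2 * (N + 1 - k))) * (1 - q ^ (2 * (N + 1 + k)))) := by
  induction k with
  | zero => simp [centralRatio_zero, sq]
  | succ k ih =>
    have hd := (one_sub_pow_pos h0 h1 (m := 2 * (N + k + 1)) (by omega)).ne'
    have hd' := (one_sub_pow_pos h0 h1 (m := 2 * (N + 1 + k + 1)) (by omega)).ne'
    rw [centralRatio_succ, mul_right_comm, ih, centralRatio_succ, Nat.add_sub_add_right,
      ← add_assoc (N + 1) k 1]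
    rw [show N + 1 + k = N + k + 1 by omega] at hd' ⊢
    field_simp

/-- The partial sums of `Σ_{k∈ℤ} (-1)^k q^{k²}`, with weights `centralRatio`. -/
def weightedPartialSum (q : ℝ) (N K : ℕ) : ℝ :=
  1 + 2 * ∑ k ∈ Finset.range K, (-1) ^ (k + 1) * q ^ ((k + 1) ^ 2) * centralRatio q N (k + 1)

lemma weightedPartialSum_succ (q : ℝ) (N K : ℕ) :
    weightedPartialSum q N (K + 1) = weightedPartialSum q N K +
      2 * ((-1) ^ (K + 1) * q ^ ((K + 1) ^ 2) * centralRatio q N (K + 1)) := by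
  rw [weightedPartialSum, Finset.sum_range_succ, weightedPartialSum]
  ring

/-- A telescoping identity for consecutive weighted partial sums. -/
lemma weightedPartialSum_telescope {q : ℝ} (h0 : 0 < q) (h1 : q < 1) {N K : ℕ} (hK : K ≤ N + 1) :
    weightedPartialSum q (N + 1) K *
        ((q + q ^ (2 * (N + 1))) * (1 - (q ^ (2 * (N + 1))) ^ 2)) -
      weightedPartialSum q N K * ((q - q ^ (2 * (N + 1))) * (1 - q ^ (2 * (N + 1))) ^ 2) =
    2 * (centralRatio q (N + 1) K * ((-1) ^ K * q ^ K ^ 2) * (1 - q ^ (2 * (N + 1 - K))) *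
      (q ^ (2 * (N + 1)) * (q ^ (2 * K + 1) + 1))) := by
  induction K with
  | zero =>
    simp [weightedPartialSum, centralRatio_zero]
    ring
  | succ K ih =>
    have ih := ih (by omega)
    obtain ⟨M, rfl⟩ : ∃ M, N = K + M := ⟨N - K, by omega⟩
    have hd := (one_sub_pow_pos h0 h1 (m := 2 * (K + M + 1 + K + 1)) (by omega)).ne'
    have hC := centralRatio_mul_sq h0 h1 (K + M) (K + 1)
    have hC0 : centralRatio q (K + M + 1) (K + 1) * (1 - q ^ (2 * (K + M + 1 + K + 1))) =
        centralRatio q (K + M + 1) K * (1 - q ^ (2 * (K + M + 1 - K))) := by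
      rw [centralRatio_succ]
      field_simp
    rw [weightedPartialSum_succ, weightedPartialSum_succ]
    rw [show K + M + 1 - (K + 1) = M by omega] at hC ⊢
    rw [show K + M + 1 - K = M + 1 by omega] at hC0 ih
    rw [show K + M + 1 + (K + 1) = K + M + 1 + K + 1 by omega] at hC
    generalize centralRatio q (K + M + 1) (K + 1) = C at *
    generalize centralRatio q (K + M) (K + 1) = B at *
    generalize centralRatio q (K + M + 1) K = A at *
    generalize weightedPartialSum q (K + M + 1) K = S at *
    generalize weightedPartialSum q (K + M) K = T at *
    have e1 : q ^ (2 * (K + M + 1)) = q ^ (2 * K) * q ^ (2 * M) * q ^ 2 := by ring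
    have e2 : q ^ (2 * (K + M + 1 + K + 1)) = (q ^ (2 * K)) ^ 2 * q ^ (2 * M) * q ^ 4 := by ring
    have e3 : q ^ (2 * (M + 1)) = q ^ (2 * M) * q ^ 2 := by ring
    have e4 : q ^ (K + 1) ^ 2 = q ^ K ^ 2 * q ^ (2 * K) * q := by ring
    have e5 : q ^ (2 * (K + 1) + 1) = q ^ (2 * K) * q ^ 3 := by ring
    have e6 : q ^ (2 * K + 1) = q ^ (2 * K) * q := by ring
    rw [e1, e2] at hC
    rw [e2, e3] at hC0
    rw [e1, e3, e6] at ih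
    rw [e1, e4, e5, pow_succ (-1 : ℝ) K]
    generalize q ^ (2 * K) = x at *
    generalize q ^ (2 * M) = y at *
    generalize q ^ K ^ 2 = u at *
    generalize (-1 : ℝ) ^ K = s at *
    linear_combination ih - 2 * s * u * (x * y * q ^ 2) * (x * q + 1) * hC0 +
      2 * s * u * x * q * (q - x * y * q ^ 2) * hC

/-- A finite form of Gauss's identity `Σ_{k∈ℤ} (-1)^k q^{k²} = ∏_{n≥1} (1 - qⁿ) / (1 + qⁿ)`. -/
lemma weightedPartialSum_eq_prod {q : ℝ} (h0 : 0 < q) (h1 : q < 1) (N : ℕ) :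
    weightedPartialSum q N N =
      ∏ j ∈ Finset.range (2 * N), (1 - q ^ (j + 1)) / (1 + q ^ (j + 1)) := by
  induction N with
  | zero => simp [weightedPartialSum]
  | succ N ih =>
    have htel := weightedPartialSum_telescope h0 h1 (le_refl (N + 1))
    rw [Nat.sub_self, mul_zero, pow_zero, sub_self, mul_zero, zero_mul, mul_zero,
      weightedPartialSum_succ q N N, centralRatio_eq_zero q (Nat.lt_succ_self N), mul_zero,
      mul_zero, add_zero, ih, sub_eq_zero] at htel
    rw [show 2 * (N + 1) = 2 * N + 1 + 1 by ring, Finset.prod_range_succ,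
      Finset.prod_range_succ]
    generalize ∏ j ∈ Finset.range (2 * N), (1 - q ^ (j + 1)) / (1 + q ^ (j + 1)) = P at *
    have hlt := one_sub_pow_pos h0 h1 (m := 2 * N + 1 + 1) (by omega)
    have hpos : 0 < q ^ (2 * N + 1) := by positivity
    rw [show 2 * (N + 1) = 2 * N + 1 + 1 by ring, pow_succ q (2 * N + 1)] at htel
    rw [pow_succ q (2 * N + 1)] at hlt ⊢
    generalize q ^ (2 * N + 1) = b at *
    have h2 : 0 < 1 + b * q := by positivity
    have h3 : 0 < 1 + b := by positivity
    have hcancel : q * (1 - b * q) ≠ 0 := mul_ne_zero h0.ne' hlt.ne'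
    field_simp
    refine mul_left_cancel₀ hcancel ?_
    linear_combination htel

lemma tendsto_weightedPartialSum {q : ℝ} (h0 : 0 < q) (h1 : q < 1) :
    Tendsto (fun N => weightedPartialSum q N N) atTop
      (nhds (1 + 2 * ∑' k : ℕ, (-1) ^ (k + 1) * q ^ ((k + 1) ^ 2))) := by
  have hsum : ∀ N, weightedPartialSum q N N =
      1 + 2 * ∑' k : ℕ, (-1) ^ (k + 1) * q ^ ((k + 1) ^ 2) * centralRatio q N (k + 1) := fun N => by
    rw [weightedPartialSum, tsum_eq_sum fun k hk => ?_]
    rw [centralRatio_eq_zero q (by simpa [Nat.lt_succ_iff] using hk), mul_zero]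
  simp_rw [hsum]
  refine Tendsto.const_add _ (Tendsto.const_mul _ ?_)
  refine tendsto_tsum_of_dominated_convergence (summable_geometric_of_lt_one h0.le h1)
    (fun k => ?_) (Eventually.of_forall fun N k => ?_)
  · simpa using (tendsto_centralRatio h0 h1 (k + 1)).const_mul ((-1) ^ (k + 1) * q ^ ((k + 1) ^ 2))
  · rw [Real.norm_eq_abs, abs_mul, abs_mul, abs_pow, abs_neg, abs_one, one_pow, one_mul,
      abs_of_pos (pow_pos h0 _)]
    refine (mul_le_of_le_one_right (pow_pos h0 _).le (abs_centralRatio_le h0 h1 N _)).trans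
      (pow_le_pow_of_le_one h0.le h1.le (by nlinarith))

lemma neg_one_zpow_mul_exp_natCast (c : ℝ) (m : ℕ) :
    (-1 : ℝ) ^ (m : ℤ) * Real.exp (-Real.pi * c * ((m : ℤ) : ℝ) ^ 2) =
      (-1) ^ m * Real.exp (-(Real.pi * c)) ^ (m ^ 2) := by
  rw [← Real.exp_nat_mul, zpow_natCast]
  push_cast
  ring_nf

lemma theta4_eq_nat_tsum {c : ℝ} (hc : 0 < c) :
    theta4 c = 1 + 2 * ∑' k : ℕ, (-1) ^ (k + 1) * Real.exp (-(Real.pi * c)) ^ ((k + 1) ^ 2) := by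
  set f : ℤ → ℝ := fun k => (-1 : ℝ) ^ k * Real.exp (-Real.pi * c * (k : ℝ) ^ 2) with hf
  have hs : Summable f := by
    refine (summable_sq_pow_mul_exp 0 hc).of_norm_bounded fun k => ?_
    simpa only [pow_zero, mul_one, one_mul] using
      norm_thetaSeries_term_le abs_neg_one_zpow_le 0 (le_refl c) k
  have heven : ∀ k, f (-k) = f k := fun k => by
    simp only [hf, zpow_neg, ← inv_zpow, inv_neg_one, Int.cast_neg, neg_sq]
  have hterm : ∀ k : ℕ, f (k + 1) =
      (-1) ^ (k + 1) * Real.exp (-(Real.pi * c)) ^ ((k + 1) ^ 2) := fun k =>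
    neg_one_zpow_mul_exp_natCast c (k + 1)
  have hzero : f 0 = 1 := by simp [hf]
  have hpos : Summable fun k : ℕ => f (k + 1) :=
    hs.comp_injective (i := fun k : ℕ => (k : ℤ) + 1) fun _ _ h => by simpa using h
  have htheta : theta4 c = ∑' k, f k := rfl
  rw [htheta, tsum_of_add_one_of_neg_add_one hpos (by simpa only [heven] using hpos), hzero]
  simp_rw [heven, hterm]
  ring

/-- `log (tanh (u / 2))`, written in terms of `e^{-u}`. -/
def logTanhHalf (u : ℝ) : ℝ := Real.log ((1 - Real.exp (-u)) / (1 + Real.exp (-u)))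

lemma exp_neg_lt_one {u : ℝ} (hu : 0 < u) : Real.exp (-u) < 1 := by
  simpa using hu

lemma hasDerivAt_logTanhHalf {u : ℝ} (hu : 0 < u) :
    HasDerivAt logTanhHalf (1 / Real.sinh u) u := by
  have hlt := exp_neg_lt_one hu
  have hpos := Real.exp_pos (-u)
  have hE : HasDerivAt (fun v => Real.exp (-v)) (-Real.exp (-u)) u := by
    simpa using (hasDerivAt_neg u).exp
  have hminus : 1 - Real.exp (-u) ≠ 0 := (sub_pos.mpr hlt).ne'
  have hplus : 1 + Real.exp (-u) ≠ 0 := by positivity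
  have hsinh := (Real.sinh_pos_iff.mpr hu).ne'
  refine ((((hE.const_sub 1).div (hE.const_add 1) hplus).log
    (div_ne_zero hminus hplus))).congr_deriv ?_
  have hs : Real.sinh u * (2 * Real.exp (-u)) = 1 - Real.exp (-u) ^ 2 := by
    rw [Real.sinh_eq]
    have : Real.exp u * Real.exp (-u) = 1 := by rw [← Real.exp_add]; simp
    linear_combination this
  simp only [Pi.div_apply]
  field_simp
  linear_combination hs

lemma hasDerivAt_logTanhHalf_exp {a : ℝ} (ha : 0 < a) (t : ℝ) :
    HasDerivAt (fun s => logTanhHalf (a * Real.exp s))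
      (a * Real.exp t / Real.sinh (a * Real.exp t)) t := by
  refine ((hasDerivAt_logTanhHalf (by positivity : 0 < a * Real.exp t)).comp t
    ((Real.hasDerivAt_exp t).const_mul a)).congr_deriv ?_
  ring

lemma sinh_lt_mul_cosh {u : ℝ} (hu : 0 < u) : Real.sinh u < u * Real.cosh u := by
  have hderiv : ∀ x : ℝ, HasDerivAt (fun x => x * Real.cosh x - Real.sinh x)
      (x * Real.sinh x) x := fun x =>
    (((hasDerivAt_id x).mul (Real.hasDerivAt_cosh x)).sub (Real.hasDerivAt_sinh x)).congr_deriv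
      (by simp)
  have hmono : StrictMonoOn (fun x => x * Real.cosh x - Real.sinh x) (Set.Ici 0) := by
    refine strictMonoOn_of_deriv_pos (convex_Ici 0)
      (fun x _ => (hderiv x).continuousAt.continuousWithinAt) fun x hx => ?_
    rw [interior_Ici, Set.mem_Ioi] at hx
    rw [(hderiv x).deriv]
    exact mul_pos hx (Real.sinh_pos_iff.mpr hx)
  simpa using hmono Set.self_mem_Ici hu.le hu

lemma exists_neg_hasDerivAt_div_sinh {a : ℝ} (ha : 0 < a) (t : ℝ) :
    ∃ d < 0, HasDerivAt (fun s => a * Real.exp s / Real.sinh (a * Real.exp s)) d t := by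
  have hu : 0 < a * Real.exp t := by positivity
  have hs := Real.sinh_pos_iff.mpr hu
  have hexp := (Real.hasDerivAt_exp t).const_mul a
  refine ⟨_, ?_, hexp.div hexp.sinh hs.ne'⟩
  refine div_neg_of_neg_of_pos ?_ (by positivity)
  nlinarith [mul_pos hu (sub_pos.mpr (sinh_lt_mul_cosh hu))]

lemma concaveOn_logTanhHalf_exp {a : ℝ} (ha : 0 < a) :
    ConcaveOn ℝ Set.univ fun s => logTanhHalf (a * Real.exp s) := by
  refine Antitone.concaveOn_univ_of_deriv
    (fun t => (hasDerivAt_logTanhHalf_exp ha t).differentiableAt) ?_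
  rw [funext fun t => (hasDerivAt_logTanhHalf_exp ha t).deriv]
  refine antitone_of_deriv_nonpos (fun t => ?_) fun t => ?_
  all_goals obtain ⟨d, hd, h⟩ := exists_neg_hasDerivAt_div_sinh ha t
  · exact h.differentiableAt
  · exact h.deriv.le.trans hd.le

lemma summable_logTanhHalf {c : ℝ} (hc : 0 < c) :
    Summable fun j : ℕ => logTanhHalf ((j + 1) * Real.pi * c) := by
  have hpos : 0 < Real.pi * c := mul_pos Real.pi_pos hc
  have hgeom : Summable fun j : ℕ => Real.exp (-(((j : ℝ) + 1) * Real.pi * c)) := by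
    have h := (summable_geometric_of_lt_one (Real.exp_pos _).le (exp_neg_lt_one hpos)).mul_left
      (Real.exp (-(Real.pi * c)))
    refine h.congr fun j => ?_
    rw [← Real.exp_nat_mul, ← Real.exp_add]
    ring_nf
  have hbound : Summable fun j : ℕ => -2 * Real.exp (-(((j : ℝ) + 1) * Real.pi * c)) /
      (1 + Real.exp (-(((j : ℝ) + 1) * Real.pi * c))) := by
    refine (hgeom.mul_left 2).of_norm_bounded fun j => ?_
    have hE := Real.exp_pos (-(((j : ℝ) + 1) * Real.pi * c))
    rw [neg_mul, neg_div, norm_neg, Real.norm_of_nonneg (by positivity)]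
    exact div_le_self (by positivity) (by linarith)
  refine (Real.summable_log_one_add_of_summable hbound).congr fun j => ?_
  have hE := Real.exp_pos (-(((j : ℝ) + 1) * Real.pi * c))
  rw [logTanhHalf]
  congr 1
  field_simp
  ring

lemma theta4_eq_exp_tsum {c : ℝ} (hc : 0 < c) :
    theta4 c = Real.exp (∑' j : ℕ, logTanhHalf ((j + 1) * Real.pi * c)) := by
  have hpos : 0 < Real.pi * c := mul_pos Real.pi_pos hc
  have hq0 := Real.exp_pos (-(Real.pi * c))
  have hq1 := exp_neg_lt_one hpos
  have htheta := tendsto_weightedPartialSum hq0 hq1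
  rw [← theta4_eq_nat_tsum hc] at htheta
  have hexp := (Real.continuous_exp.tendsto _).comp
    ((summable_logTanhHalf hc).hasSum.tendsto_sum_nat.comp
      (tendsto_id.const_mul_atTop' (two_pos : 0 < 2)))
  refine tendsto_nhds_unique htheta (hexp.congr fun N => ?_)
  rw [weightedPartialSum_eq_prod hq0 hq1]
  simp only [Function.comp_apply, id_eq, Real.exp_sum]
  refine Finset.prod_congr rfl fun j _ => ?_
  have hu : 0 < ((j : ℝ) + 1) * Real.pi * c := by positivity
  rw [logTanhHalf, Real.exp_log (div_pos (sub_pos.mpr (exp_neg_lt_one hu)) (by positivity)),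
    ← Real.exp_nat_mul]
  push_cast
  ring_nf

lemma theta4_pos {c : ℝ} (hc : 0 < c) : 0 < theta4 c := by
  rw [theta4_eq_exp_tsum hc]
  exact Real.exp_pos _

/-- Removing the first factor from the infinite product for `theta4` leaves a function that is
logarithmically concave in the logarithm of its argument. -/
lemma concaveOn_log_theta4_sub :
    ConcaveOn ℝ Set.univ fun t =>
      Real.log (theta4 (Real.exp t)) - logTanhHalf (Real.pi * Real.exp t) := by
  have hsum : ∀ t : ℝ, Summable fun j : ℕ =>
      logTanhHalf (((j : ℝ) + 1 + 1) * Real.pi * Real.exp t) := fun t => by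
    simpa using (summable_nat_add_iff 1).mpr (summable_logTanhHalf (Real.exp_pos t))
  have heq : (fun t => Real.log (theta4 (Real.exp t)) - logTanhHalf (Real.pi * Real.exp t)) =
      fun t => ∑' j : ℕ, logTanhHalf (((j : ℝ) + 1 + 1) * Real.pi * Real.exp t) := by
    ext t
    rw [theta4_eq_exp_tsum (Real.exp_pos t), Real.log_exp,
      (summable_logTanhHalf (Real.exp_pos t)).tsum_eq_zero_add]
    simp
  rw [heq]
  refine ⟨convex_univ, fun x _ y _ a b ha hb hab => ?_⟩
  simp only [smul_eq_mul]
  rw [← tsum_mul_left, ← tsum_mul_left,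
    ← ((hsum x).mul_left a).tsum_add ((hsum y).mul_left b)]
  refine (((hsum x).mul_left a).add ((hsum y).mul_left b)).tsum_le_tsum (fun j => ?_) (hsum _)
  exact (concaveOn_logTanhHalf_exp (by positivity : 0 < ((j : ℝ) + 1 + 1) * Real.pi)).2
    (Set.mem_univ x) (Set.mem_univ y) ha hb hab

lemma Qfun_neg {c : ℝ} (hc : 0 < c) : Qfun c < 0 := by
  obtain ⟨t, rfl⟩ : ∃ t, Real.exp t = c := ⟨Real.log c, Real.exp_log hc⟩
  let a : ℤ → ℝ := fun k => (-1) ^ k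
  have hθ : ∀ s, 0 < thetaSeries a 0 (Real.exp s) := fun s => by
    have h := theta4_pos (Real.exp_pos s)
    rwa [theta4_eq_thetaSeries] at h
  have hcomp : ∀ n s, HasDerivAt (fun r => thetaSeries a n (Real.exp r))
      (thetaSeries a (n + 1) (Real.exp s) * Real.exp s) s := fun n s =>
    (hasDerivAt_thetaSeries abs_neg_one_zpow_le n (Real.exp_pos s)).comp s (Real.hasDerivAt_exp s)
  have hconc := concaveOn_log_theta4_sub
  rw [theta4_eq_thetaSeries] at hconc
  have hD : ∀ s, HasDerivAt
      (fun r => Real.log (thetaSeries a 0 (Real.exp r)) - logTanhHalf (Real.pi * Real.exp r))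
      (thetaSeries a 1 (Real.exp s) * Real.exp s / thetaSeries a 0 (Real.exp s) -
        Real.pi * Real.exp s / Real.sinh (Real.pi * Real.exp s)) s := fun s =>
    ((hcomp 0 s).log (hθ s).ne').sub (hasDerivAt_logTanhHalf_exp Real.pi_pos s)
  have hanti : Antitone fun s =>
      thetaSeries a 1 (Real.exp s) * Real.exp s / thetaSeries a 0 (Real.exp s) -
        Real.pi * Real.exp s / Real.sinh (Real.pi * Real.exp s) := by
    rw [← funext fun s => (hD s).deriv, ← antitoneOn_univ]
    exact hconc.antitoneOn_deriv fun s _ => (hD s).differentiableAt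
  obtain ⟨d, hd, hderiv⟩ := exists_neg_hasDerivAt_div_sinh Real.pi_pos t
  have hD2 := (((hcomp 1 t).mul (Real.hasDerivAt_exp t)).div (hcomp 0 t) (hθ t).ne').sub hderiv
  have hle := hD2.deriv.symm.le.trans hanti.deriv_nonpos
  have hlt := lt_of_le_of_lt (sub_nonpos.mp hle) hd
  rw [div_lt_iff₀ (by have := hθ t; positivity), zero_mul] at hlt
  rw [Qfun_eq_thetaCurvature hc, thetaCurvature]
  simp only [Pi.mul_apply] at hlt
  change 2 * Real.exp t ^ 2 * (thetaSeries a 0 (Real.exp t) * thetaSeries a 2 (Real.exp t) -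
    thetaSeries a 1 (Real.exp t) ^ 2) +
    2 * Real.exp t * thetaSeries a 0 (Real.exp t) * thetaSeries a 1 (Real.exp t) < 0
  norm_num at hlt
  linarith

/-- For `β > α > 0`, `-Q(αV) > 0` for all `V > 0` and
`e^{πV(β-α)}·P(βV)/(-Q(αV)) → β²/α²` as `V → ∞`. -/
theorem ratio_asymptotics (α β : ℝ) (hα : 0 < α) (hαβ : α < β) :
    (∀ V : ℝ, 0 < V → 0 < -Qfun (α * V)) ∧
    Tendsto (fun V : ℝ =>
        Real.exp (Real.pi * V * (β - α)) * Pfun (β * V) / (-Qfun (α * V)))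
      atTop (nhds (β ^ 2 / α ^ 2)) := by
  have hβ := hα.trans hαβ
  exact ⟨fun V hV => neg_pos.mpr (Qfun_neg (mul_pos hα hV)), tendsto_ratio hα hβ⟩
end
end

section
/- For every c > 0, the function y ↦ θ₄(cy)·θ₄(c/y) is twice differentiable at y = 1 with second derivative there equal to 2c²(θ₄(c)·θ₄''(c) − θ₄'(c)²) + 2c·θ₄(c)·θ₄'(c), and this expression tends to 0 as c → 0⁺: lim_{c→0⁺} [ 2c²(θ₄(c)θ₄''(c) − θ₄'(c)²) + 2c·θ₄(c)θ₄'(c) ] = 0. -/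
open Filter

noncomputable section

/-- Holomorphic extension of `theta4` to the right half-plane. -/
def complexTheta4 (z : ℂ) : ℂ := jacobiTheta₂ (1 / 2) (Complex.I * z)

lemma theta4_eq_re_complexTheta4 (x : ℝ) : theta4 x = (complexTheta4 x).re := by
  have h : complexTheta4 x = ((theta4 x : ℝ) : ℂ) := by
    rw [complexTheta4, jacobiTheta₂, theta4, Complex.ofReal_tsum]
    refine tsum_congr fun k => ?_
    have hk : (-1 : ℂ) ^ k = Complex.exp (Real.pi * Complex.I * k) := by
      rw [mul_comm _ (k : ℂ), Complex.exp_int_mul, Complex.exp_pi_mul_I]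
    rw [jacobiTheta₂_term]
    push_cast
    rw [hk, ← Complex.exp_add]
    congr 1
    linear_combination (Real.pi * k ^ 2 * x : ℂ) * Complex.I_sq
  rw [h, Complex.ofReal_re]

lemma differentiableAt_complexTheta4 {z : ℂ} (hz : 0 < z.re) :
    DifferentiableAt ℂ complexTheta4 z := by
  have h : 0 < (Complex.I * z).im := by simpa using hz
  exact (differentiableAt_jacobiTheta₂_snd (1 / 2) h).comp z (by fun_prop)

lemma differentiableOn_complexTheta4 : DifferentiableOn ℂ complexTheta4 {z | 0 < z.re} :=
  fun _ hz => (differentiableAt_complexTheta4 hz).differentiableWithinAt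

lemma differentiableAt_deriv_complexTheta4 {z : ℂ} (hz : 0 < z.re) :
    DifferentiableAt ℂ (deriv complexTheta4) z :=
  (differentiableOn_complexTheta4.deriv
    (isOpen_lt continuous_const Complex.continuous_re)).differentiableAt
    ((isOpen_lt continuous_const Complex.continuous_re).mem_nhds hz)

lemma hasDerivAt_theta4_re {x : ℝ} (hx : 0 < x) :
    HasDerivAt theta4 (deriv complexTheta4 x).re x := by
  rw [funext theta4_eq_re_complexTheta4]
  exact (differentiableAt_complexTheta4 (by simpa using hx)).hasDerivAt.real_of_complex

lemma hasDerivAt_deriv_theta4_re {x : ℝ} (hx : 0 < x) :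
    HasDerivAt (deriv theta4) (deriv (deriv complexTheta4) x).re x := by
  refine (differentiableAt_deriv_complexTheta4
    (z := x) (by simpa using hx)).hasDerivAt.real_of_complex.congr_of_eventuallyEq ?_
  filter_upwards [lt_mem_nhds hx] with y hy using (hasDerivAt_theta4_re hy).deriv

lemma hasDerivAt_theta4 {x : ℝ} (hx : 0 < x) : HasDerivAt theta4 (deriv theta4 x) x :=
  (hasDerivAt_theta4_re hx).differentiableAt.hasDerivAt

lemma hasDerivAt_deriv_theta4 {x : ℝ} (hx : 0 < x) :
    HasDerivAt (deriv theta4) (deriv (deriv theta4) x) x :=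
  (hasDerivAt_deriv_theta4_re hx).differentiableAt.hasDerivAt

lemma hasDerivAt_theta4_mul_theta4 {c y : ℝ} (hc : 0 < c) (hy : 0 < y) :
    HasDerivAt (fun y : ℝ => theta4 (c * y) * theta4 (c / y))
      (c * deriv theta4 (c * y) * theta4 (c / y)
        - c * (theta4 (c * y) * deriv theta4 (c / y)) / y ^ 2) y := by
  have h₁ : HasDerivAt (fun y : ℝ => c * y) c y := by
    simpa using (hasDerivAt_id y).const_mul c
  have h₂ : HasDerivAt (fun y : ℝ => c / y) (-c / y ^ 2) y := by
    simpa using (hasDerivAt_const y c).fun_div (hasDerivAt_id y) hy.ne'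
  refine (((hasDerivAt_theta4 (mul_pos hc hy)).comp y h₁).mul
    ((hasDerivAt_theta4 (div_pos hc hy)).comp y h₂)).congr_deriv ?_
  simp only [Function.comp_apply]
  ring

lemma hasDerivAt_deriv_theta4_mul_theta4 {c : ℝ} (hc : 0 < c) :
    HasDerivAt (deriv (fun y : ℝ => theta4 (c * y) * theta4 (c / y)))
      (2 * c ^ 2 * (theta4 c * deriv (deriv theta4) c - (deriv theta4 c) ^ 2)
        + 2 * c * theta4 c * deriv theta4 c) 1 := by
  have h₁ : HasDerivAt (fun y : ℝ => c * y) c 1 := by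
    simpa using (hasDerivAt_id (1 : ℝ)).const_mul c
  have h₂ : HasDerivAt (fun y : ℝ => c / y) (-c) 1 := by
    simpa using (hasDerivAt_const (1 : ℝ) c).fun_div (hasDerivAt_id 1) one_ne_zero
  have hc₁ : 0 < c * 1 := by simpa using hc
  have hc₂ : 0 < c / 1 := by simpa using hc
  have f₁ := (hasDerivAt_theta4 hc₁).comp 1 h₁
  have f₂ := (hasDerivAt_theta4 hc₂).comp 1 h₂
  have g₁ := (hasDerivAt_deriv_theta4 hc₁).comp 1 h₁
  have g₂ := (hasDerivAt_deriv_theta4 hc₂).comp 1 h₂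
  have key := ((g₁.const_mul c).mul f₂).sub
    (((f₁.mul g₂).const_mul c).div (hasDerivAt_pow 2 (1 : ℝ)) (by norm_num))
  refine (key.congr_of_eventuallyEq ?_).congr_deriv ?_
  · filter_upwards [lt_mem_nhds (zero_lt_one' ℝ)] with y hy
    exact (hasDerivAt_theta4_mul_theta4 hc hy).deriv
  · simp only [Function.comp_apply, mul_one, div_one, Pi.mul_apply]
    norm_num
    ring

/-- The sum over `n ∈ ℤ` of `e^{-π(n² - n)}`. -/
def thetaBound : ℝ := ∑' n : ℤ, Real.exp (-Real.pi * ((n : ℝ) ^ 2 - n))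

lemma summable_exp_neg_pi_mul_sq_sub :
    Summable fun n : ℤ => Real.exp (-Real.pi * ((n : ℝ) ^ 2 - n)) := by
  have h := ((summable_jacobiTheta₂_term_iff (-Complex.I / 2) Complex.I).2 (by simp)).norm
  refine h.congr fun n => ?_
  rw [norm_jacobiTheta₂_term]
  congr 1
  simp
  ring

lemma norm_jacobiTheta₂_le_thetaBound {z τ : ℂ} (hτ : 1 ≤ τ.im) (hz : z.im = -τ.im / 2) :
    ‖jacobiTheta₂ z τ‖ ≤ thetaBound := by
  refine tsum_of_norm_bounded summable_exp_neg_pi_mul_sq_sub.hasSum fun n => ?_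
  rw [norm_jacobiTheta₂_term, Real.exp_le_exp, hz]
  have hn : (0 : ℝ) ≤ (n : ℝ) ^ 2 - n := by
    have : n ≤ n ^ 2 := Int.le_self_sq n
    have : (n : ℝ) ≤ (n : ℝ) ^ 2 := by exact_mod_cast this
    linarith
  have := mul_nonneg (mul_nonneg Real.pi_pos.le hn) (sub_nonneg.2 hτ)
  linarith

lemma norm_complexTheta4_le {z : ℂ} (hz : 1 ≤ (1 / z).re) :
    ‖complexTheta4 z‖ ≤
      1 / ‖z‖ ^ (1 / 2 : ℝ) * Real.exp (-Real.pi / 4 * (1 / z).re) * thetaBound := by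
  have hz0 : z ≠ 0 := by
    rintro rfl
    norm_num at hz
  have h₁ : -Complex.I * (Complex.I * z) = z := by
    linear_combination -z * Complex.I_sq
  have h₂ : -Real.pi * Complex.I * (1 / 2) ^ 2 / (Complex.I * z)
      = ((-Real.pi / 4 : ℝ) : ℂ) * (1 / z) := by
    push_cast
    field_simp [Complex.I_ne_zero]
    norm_num
  have h₃ : -1 / (Complex.I * z) = Complex.I * (1 / z) := by
    field_simp [Complex.I_ne_zero]
    rw [Complex.I_sq]
  have h₄ : 1 / 2 / (Complex.I * z) = -Complex.I * ((1 / 2 : ℝ) * (1 / z)) := by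
    push_cast
    field_simp [Complex.I_ne_zero]
    rw [Complex.I_sq]
    norm_num
  rw [complexTheta4, jacobiTheta₂_functional_equation, h₁, h₂, h₃, h₄, norm_mul, norm_mul,
    norm_div, norm_one, Complex.norm_cpow_of_ne_zero hz0, Complex.norm_exp, Complex.re_ofReal_mul]
  have h₅ : ‖jacobiTheta₂ (-Complex.I * ((1 / 2 : ℝ) * (1 / z))) (Complex.I * (1 / z))‖
      ≤ thetaBound := by
    refine norm_jacobiTheta₂_le_thetaBound (by rwa [Complex.I_mul_im]) ?_
    rw [Complex.I_mul_im, neg_mul, Complex.neg_im, Complex.I_mul_im, Complex.re_ofReal_mul]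
    ring
  have h₆ : ((1 / 2 : ℂ)).re = 1 / 2 ∧ ((1 / 2 : ℂ)).im = 0 := by norm_num
  rw [h₆.1, h₆.2, mul_zero, Real.exp_zero, div_one]
  gcongr

/-- A bound for `complexTheta4` on the closed disc of radius `c / 2` around `c`. -/
def discBound (c : ℝ) : ℝ :=
  1 / (c / 2) ^ (1 / 2 : ℝ) * Real.exp (-Real.pi / 4 * (2 / (9 * c))) * thetaBound

lemma norm_complexTheta4_le_discBound {c : ℝ} (hc : 0 < c) (hc' : c ≤ 2 / 9) {z : ℂ}
    (hz : ‖z - c‖ ≤ c / 2) : ‖complexTheta4 z‖ ≤ discBound c := by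
  have hre : c / 2 ≤ z.re := by
    have := (abs_le.1 ((Complex.abs_re_le_norm _).trans hz)).1
    rw [Complex.sub_re, Complex.ofReal_re] at this
    linarith
  have hlow : c / 2 ≤ ‖z‖ := hre.trans (Complex.re_le_norm z)
  have hup : ‖z‖ ≤ 3 / 2 * c := by
    have h := norm_add_le (z - c) (c : ℂ)
    rw [sub_add_cancel, Complex.norm_of_nonneg hc.le] at h
    linarith
  have hinv : 2 / (9 * c) ≤ (1 / z).re := by
    have hpos : 0 < ‖z‖ := by linarith
    rw [one_div, Complex.inv_re, Complex.normSq_eq_norm_sq, div_le_div_iff₀ (by positivity)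
      (by positivity)]
    nlinarith
  have hone : 1 ≤ 2 / (9 * c) := by
    rw [le_div_iff₀ (by positivity)]
    linarith
  have hB : 0 ≤ thetaBound := tsum_nonneg fun _ => (Real.exp_pos _).le
  refine (norm_complexTheta4_le (hone.trans hinv)).trans ?_
  have hexp : -Real.pi / 4 * (1 / z).re ≤ -Real.pi / 4 * (2 / (9 * c)) :=
    mul_le_mul_of_nonpos_left hinv (by linarith [Real.pi_pos])
  unfold discBound
  gcongr

lemma tendsto_discBound : Tendsto discBound (nhdsWithin 0 (Set.Ioi 0)) (nhds 0) := by
  have h := ((tendsto_rpow_mul_exp_neg_mul_atTop_nhds_zero (1 / 2) (Real.pi / 36)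
    (by positivity)).mul_const thetaBound).comp
      (tendsto_inv_nhdsGT_zero.const_mul_atTop (zero_lt_two' ℝ))
  rw [zero_mul] at h
  refine h.congr' ?_
  filter_upwards [self_mem_nhdsWithin] with c hc
  have hc : 0 < c := hc
  have h₁ : 2 * c⁻¹ = (c / 2)⁻¹ := by rw [inv_div]; rfl
  have h₂ : -(Real.pi / 36) * (2 * c⁻¹) = -Real.pi / 4 * (2 / (9 * c)) := by
    field_simp
    norm_num
  simp only [Function.comp_apply, discBound]
  rw [h₂, h₁, Real.inv_rpow (by positivity), ← one_div ((c / 2) ^ (1 / 2 : ℝ))]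

lemma abs_theta4_le {c : ℝ} (hc : 0 < c) (hc' : c ≤ 2 / 9) : |theta4 c| ≤ discBound c := by
  rw [theta4_eq_re_complexTheta4]
  exact (Complex.abs_re_le_norm _).trans
    (norm_complexTheta4_le_discBound hc hc' (by simpa using by positivity))

lemma norm_iteratedDeriv_complexTheta4_le {c : ℝ} (hc : 0 < c) (hc' : c ≤ 2 / 9) (n : ℕ) :
    ‖iteratedDeriv n complexTheta4 c‖ ≤ n.factorial * discBound c / (c / 2) ^ n := by
  refine Complex.norm_iteratedDeriv_le_of_forall_mem_sphere_norm_le n (half_pos hc) ?_ fun z hz =>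
    norm_complexTheta4_le_discBound hc hc' (mem_sphere_iff_norm.1 hz).le
  refine (differentiableOn_complexTheta4.mono fun z hz => ?_).diffContOnCl
  rw [closure_ball _ (half_pos hc).ne', mem_closedBall_iff_norm] at hz
  have := (abs_le.1 ((Complex.abs_re_le_norm _).trans hz)).1
  rw [Complex.sub_re, Complex.ofReal_re] at this
  change 0 < z.re
  linarith

lemma abs_mul_deriv_theta4_le {c : ℝ} (hc : 0 < c) (hc' : c ≤ 2 / 9) :
    |c * deriv theta4 c| ≤ 2 * discBound c := by
  have h := norm_iteratedDeriv_complexTheta4_le hc hc' 1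
  rw [iteratedDeriv_one] at h
  rw [(hasDerivAt_theta4_re hc).deriv, abs_mul, abs_of_pos hc]
  refine (mul_le_mul_of_nonneg_left ((Complex.abs_re_le_norm _).trans h) hc.le).trans_eq ?_
  norm_num
  field_simp

lemma abs_sq_mul_deriv_deriv_theta4_le {c : ℝ} (hc : 0 < c) (hc' : c ≤ 2 / 9) :
    |c ^ 2 * deriv (deriv theta4) c| ≤ 8 * discBound c := by
  have h := norm_iteratedDeriv_complexTheta4_le hc hc' 2
  rw [iteratedDeriv_succ, iteratedDeriv_one] at h
  rw [(hasDerivAt_deriv_theta4_re hc).deriv, abs_mul, abs_of_pos (pow_pos hc 2)]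
  refine (mul_le_mul_of_nonneg_left ((Complex.abs_re_le_norm _).trans h)
    (pow_pos hc 2).le).trans_eq ?_
  norm_num [Nat.factorial]
  field_simp
  ring

lemma tendsto_zero_of_abs_le_const_mul_discBound {f : ℝ → ℝ} (K : ℝ)
    (hf : ∀ c : ℝ, 0 < c → c ≤ 2 / 9 → |f c| ≤ K * discBound c) :
    Tendsto f (nhdsWithin 0 (Set.Ioi 0)) (nhds 0) := by
  refine squeeze_zero_norm' ?_ (by simpa using tendsto_discBound.const_mul K)
  filter_upwards [Ioc_mem_nhdsGT (show (0 : ℝ) < 2 / 9 by norm_num)] with c hc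
  exact hf c hc.1 hc.2


/-- For every `c > 0`, `y ↦ θ₄(cy)θ₄(c/y)` is twice differentiable at `y = 1`
with second derivative `2c²(θ₄(c)θ₄''(c) - θ₄'(c)²) + 2cθ₄(c)θ₄'(c)` there, and
this expression tends to `0` as `c → 0⁺`. -/
theorem theta4_second_derivative_vanishes :
    (∀ c : ℝ, 0 < c →
      DifferentiableAt ℝ (fun y : ℝ => theta4 (c * y) * theta4 (c / y)) 1 ∧
      HasDerivAt (deriv (fun y : ℝ => theta4 (c * y) * theta4 (c / y)))
        (2 * c ^ 2 * (theta4 c * deriv (deriv theta4) c - (deriv theta4 c) ^ 2)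
          + 2 * c * theta4 c * deriv theta4 c) 1) ∧
    Tendsto (fun c : ℝ =>
        2 * c ^ 2 * (theta4 c * deriv (deriv theta4) c - (deriv theta4 c) ^ 2)
          + 2 * c * theta4 c * deriv theta4 c)
      (nhdsWithin 0 (Set.Ioi 0)) (nhds 0) := by
  refine ⟨fun c hc => ⟨(hasDerivAt_theta4_mul_theta4 hc one_pos).differentiableAt,
    hasDerivAt_deriv_theta4_mul_theta4 hc⟩, ?_⟩
  have h₀ := tendsto_zero_of_abs_le_const_mul_discBound 1
    fun c hc hc' => (abs_theta4_le hc hc').trans_eq (one_mul _).symm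
  have h₁ := tendsto_zero_of_abs_le_const_mul_discBound 2
    fun c hc hc' => abs_mul_deriv_theta4_le hc hc'
  have h₂ := tendsto_zero_of_abs_le_const_mul_discBound 8
    fun c hc hc' => abs_sq_mul_deriv_deriv_theta4_le hc hc'
  have h := (((h₀.mul h₂).sub (h₁.pow 2)).add (h₀.mul h₁)).const_mul 2
  norm_num at h
  exact h.congr fun c => by ring
end
end

section
/- Let d ≥ 1, let a = (a₁,…,a_d) ∈ (0,∞)^d with a₁⋯a_d = 1, let V > 0 and β > α > 0. Set s = 1/(V^{2/d}β), t = β/α, and b = (1/a₁,…,1/a_d). Then Σ_{n∈ℤ^d} e^{−πβV^{2/d}Q_a(n)} + Σ_{n∈ℤ^d} (−1)^{n₁+⋯+n_d} e^{−παV^{2/d}Q_a(n)} = s^{d/2}·( Σ_{n∈ℤ^d} e^{−πs·Q_b(n)} + t^{d/2} Σ_{n∈ℤ^d} e^{−π t s·Σ_{i=1}^d b_i²(n_i + 1/2)²} ). -/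
noncomputable section

/-- Quadratic form of the orthorhombic lattice `L_a = a₁ℤ × ⋯ × a_dℤ`:
`Q_a(n) = a₁²n₁² + ⋯ + a_d²n_d²`. -/
def Qf (d : ℕ) (a : Fin d → ℝ) (n : Fin d → ℤ) : ℝ :=
  ∑ i, (a i) ^ 2 * (n i : ℝ) ^ 2

/-- Distributivity of finite products over absolutely convergent real series. -/
theorem hasSum_pi_prod {ι : Type*} {d : ℕ} {f : Fin d → ι → ℝ} {S : Fin d → ℝ}
    (hf : ∀ i, HasSum (f i) (S i)) :
    HasSum (fun n : Fin d → ι => ∏ i, f i (n i)) (∏ i, S i) := by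
  induction d with
  | zero => simp
  | succ d ih =>
    have htail := ih fun i => hf i.succ
    have hsummable := summable_mul_of_summable_norm (hf 0).summable.norm htail.summable.norm
    have h := (hf 0).mul htail hsummable
    rw [Fin.prod_univ_succ, ← (Fin.consEquiv fun _ : Fin (d + 1) => ι).hasSum_iff]
    have hcons : (fun n : Fin (d + 1) → ι => ∏ i, f i (n i)) ∘
        Fin.consEquiv (fun _ : Fin (d + 1) => ι) =
        fun p => f 0 p.1 * ∏ i : Fin d, f i.succ (p.2 i) := by
      funext p
      simp [Fin.consEquiv, Fin.prod_univ_succ]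
    rw [hcons]
    exact h

/-- Poisson summation for the Gaussian on an orthorhombic lattice of unit covolume, twisted by a
character `χ(n₁) ⋯ χ(n_d)`: the dual side is a sum over the dual lattice translated by `θ` times
the diagonal of its unit cell, where `χ(n) = exp (2πiθn)`. -/
theorem tsum_twisted_gaussian_orthorhombic {d : ℕ} {a : Fin d → ℝ} (ha : ∀ i, 0 < a i)
    (hprod : ∏ i, a i = 1) {c : ℝ} (hc : 0 < c) (θ : ℝ) (χ : ℤ → ℝ)
    (hχ : ∀ n : ℤ, (χ n : ℂ) = Complex.exp (2 * Real.pi * Complex.I * θ * n)) :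
    ∑' n : Fin d → ℤ, (∏ i, χ (n i)) * Real.exp (-Real.pi * c * Qf d a n) =
      (1 / c) ^ ((d : ℝ) / 2) * ∑' n : Fin d → ℤ,
        Real.exp (-Real.pi * (1 / c) * ∑ i, (a i)⁻¹ ^ 2 * ((n i : ℝ) + θ) ^ 2) := by
  have hpos (i) : 0 < c * a i ^ 2 := mul_pos hc (pow_pos (ha i) 2)
  have hcos (i) : HasSum (fun n : ℤ => χ n * Real.exp (-Real.pi * n ^ 2 * (c * a i ^ 2)))
      (HurwitzZeta.cosKernel θ (c * a i ^ 2)) := by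
    rw [← Complex.hasSum_ofReal]
    simpa [hχ] using HurwitzZeta.hasSum_int_cosKernel θ (hpos i)
  have heven (i) : HasSum (fun n : ℤ => Real.exp (-Real.pi * (n + θ) ^ 2 * (1 / (c * a i ^ 2))))
      (√c * a i * HurwitzZeta.cosKernel θ (c * a i ^ 2)) := by
    have h := HurwitzZeta.hasSum_int_evenKernel θ (one_div_pos.mpr (hpos i))
    rwa [HurwitzZeta.evenKernel_functional_equation, one_div_one_div, ← Real.sqrt_eq_rpow,
      Real.sqrt_div zero_le_one, Real.sqrt_one, one_div_one_div,
      Real.sqrt_mul hc.le, Real.sqrt_sq (ha i).le] at h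
  have hleft : HasSum
      (fun n : Fin d → ℤ => (∏ i, χ (n i)) * Real.exp (-Real.pi * c * Qf d a n))
      (∏ i, HurwitzZeta.cosKernel θ (c * a i ^ 2)) := by
    convert hasSum_pi_prod hcos using 2 with n
    rw [Finset.prod_mul_distrib, ← Real.exp_sum, Qf, Finset.mul_sum]
    congr 2
    exact Finset.sum_congr rfl fun i _ => by ring
  have hright : HasSum
      (fun n : Fin d → ℤ =>
        Real.exp (-Real.pi * (1 / c) * ∑ i, (a i)⁻¹ ^ 2 * ((n i : ℝ) + θ) ^ 2))
      (√c ^ d * ∏ i, HurwitzZeta.cosKernel θ (c * a i ^ 2)) := by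
    convert hasSum_pi_prod heven using 1
    · funext n
      rw [← Real.exp_sum, Finset.mul_sum]
      congr 1
      refine Finset.sum_congr rfl fun i _ => ?_
      have := (ha i).ne'
      field_simp
    · simp [Finset.prod_mul_distrib, hprod]
  have hpow : (1 / c) ^ ((d : ℝ) / 2) * √c ^ d = 1 := by
    rw [Real.rpow_div_two_eq_sqrt _ (one_div_pos.mpr hc).le, Real.rpow_natCast, ← mul_pow,
      ← Real.sqrt_mul (one_div_pos.mpr hc).le, one_div_mul_cancel hc.ne', Real.sqrt_one, one_pow]
  rw [hleft.tsum_eq, hright.tsum_eq, ← mul_assoc, hpow, one_mul]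

/-- The alternating sign `(-1)ⁿ` is the character `exp (2πin/2)`. -/
theorem ofReal_neg_one_zpow_eq_exp (n : ℤ) :
    (((-1 : ℝ) ^ n : ℝ) : ℂ) =
      Complex.exp (2 * Real.pi * Complex.I * ((1 / 2 : ℝ) : ℂ) * n) := by
  rw [show 2 * (Real.pi : ℂ) * Complex.I * ((1 / 2 : ℝ) : ℂ) * n = n * (Real.pi * Complex.I) by
    push_cast; ring, Complex.exp_int_mul, Complex.exp_pi_mul_I]
  push_cast
  rfl

/-- Poisson-summation identity relating the Gaussian alternating-charge lattice
energy of `V^{1/d}L_a` to theta functions of the dual lattice `L_b`, `b = a⁻¹`,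
and of its translate by the center `b/2` of its unit cell: with
`s = 1/(V^{2/d}β)` and `t = β/α`,
`θ_{V^{1/d}L_a}(β) + θ^±_{V^{1/d}L_a}(α) = s^{d/2}(θ_{L_b}(s) + t^{d/2}θ_{L_b + b/2}(ts))`. -/
theorem gaussian_energy_poisson_identity
    (d : ℕ) (hd : 1 ≤ d) (a : Fin d → ℝ) (ha : ∀ i, 0 < a i)
    (hprod : (∏ i, a i) = 1) (V α β : ℝ) (hV : 0 < V) (hα : 0 < α) (hαβ : α < β) :
    (∑' n : Fin d → ℤ, Real.exp (-Real.pi * β * V ^ ((2 : ℝ) / d) * Qf d a n))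
      + (∑' n : Fin d → ℤ,
          (-1 : ℝ) ^ (∑ i, n i) * Real.exp (-Real.pi * α * V ^ ((2 : ℝ) / d) * Qf d a n))
    = (1 / (V ^ ((2 : ℝ) / d) * β)) ^ ((d : ℝ) / 2) *
        ((∑' n : Fin d → ℤ,
            Real.exp (-Real.pi * (1 / (V ^ ((2 : ℝ) / d) * β)) *
              Qf d (fun i => (a i)⁻¹) n))
          + (β / α) ^ ((d : ℝ) / 2) *
            ∑' n : Fin d → ℤ,
              Real.exp (-Real.pi * ((β / α) * (1 / (V ^ ((2 : ℝ) / d) * β))) *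
                ∑ i, ((a i)⁻¹) ^ 2 * ((n i : ℝ) + 1 / 2) ^ 2)) := by
  have hW : 0 < V ^ ((2 : ℝ) / d) := Real.rpow_pos_of_pos hV _
  have hβ : 0 < β := hα.trans hαβ
  set W := V ^ ((2 : ℝ) / d)
  have hplain := tsum_twisted_gaussian_orthorhombic ha hprod (mul_pos hW hβ) 0 (fun _ => 1)
    (by simp)
  have halt := tsum_twisted_gaussian_orthorhombic ha hprod (mul_pos hW hα) (1 / 2)
    (fun n => (-1) ^ n) ofReal_neg_one_zpow_eq_exp
  have hsign (n : Fin d → ℤ) : (-1 : ℝ) ^ (∑ i, n i) = ∏ i, (-1 : ℝ) ^ n i := by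
    induction (Finset.univ : Finset (Fin d)) using Finset.induction_on with
    | empty => simp
    | insert i s hi ih =>
      rw [Finset.sum_insert hi, Finset.prod_insert hi, zpow_add₀ (by norm_num), ih]
  have hts : β / α * (1 / (W * β)) = 1 / (W * α) := by
    field_simp
  simp only [Finset.prod_const_one, one_mul, add_zero] at hplain
  simp only [hsign, mul_assoc (-Real.pi), mul_comm β W, mul_comm α W] at hplain halt ⊢
  rw [hplain, halt, mul_add, ← mul_assoc, ← Real.mul_rpow (by positivity) (by positivity),
    mul_comm (1 / (W * β)) (β / α), hts]
  simp only [Qf]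
end
end
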